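/- Let r ≥ 2 and d ≥ 0 be integers, let G be a graph on vertex set [n], and let e be a pair of vertices (an edge of the complete graph K_n). If e is not an edge of G and the endpoints of e are not (d+1,r)-equivalent in G, then the endpoints of e are not (d,r)-equivalent in the graph G ∪ e obtained by adding the edge e to G. -/

import Mathlib

open scoped Classical

noncomputable section

/-- The possible edges of a graph on vertex set `Fin n`. -/
abbrev EdgeType (n : ℕ) := {e : Sym2 (Fin n) // ¬ e.IsDiag}

/-- A graph on vertex set `Fin n`, identified with its edge set. -/
abbrev FinGraph (n : ℕ) := Finset (EdgeType n)

/-- The size of the `r`-cut given by `φ` in `G`. -/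
def cutSize {n r : ℕ} (φ : Fin n → Fin r) (G : FinGraph n) : ℕ :=
  (G.filter fun e => ¬ (Sym2.map φ (e : Sym2 (Fin n))).IsDiag).card

/-- The maximum size of an `r`-cut of `G`. -/
def maxCut (n r : ℕ) (G : FinGraph n) : ℕ :=
  Finset.univ.sup fun φ : Fin n → Fin r => cutSize φ G

/-- The deficit of the `r`-cut `φ` in `G`. -/
def deficit {n : ℕ} (r : ℕ) (φ : Fin n → Fin r) (G : FinGraph n) : ℕ :=
  maxCut n r G - cutSize φ G

/-- `u` and `v` are `(d,r)`-equivalent in `G`. -/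
def EqvV {n : ℕ} (d r : ℕ) (G : FinGraph n) (u v : Fin n) : Prop :=
  ∀ φ : Fin n → Fin r, deficit r φ G ≤ d → φ u = φ v

theorem cutSize_eq_card_filter {n r : ℕ} (φ : Fin n → Fin r) (G : FinGraph n) :
    cutSize φ G = (Finset.filter (fun e : EdgeType n => ¬ (Sym2.map φ e.val).IsDiag) G).card := by
  have himage : (do let a ← G; pure (a : Sym2 (Fin n))) = G.image Subtype.val := by
    ext x
    simp [Finset.bind_def, eq_comm]
  unfold cutSize
  rw [himage, Finset.filter_image, Finset.card_image_of_injective _ Subtype.val_injective]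

theorem cutSize_insert_of_ne {n r : ℕ} (φ : Fin n → Fin r) (G : FinGraph n) {u v : Fin n}
    (huv : ¬ s(u, v).IsDiag) (hG : (⟨s(u, v), huv⟩ : EdgeType n) ∉ G) (hφ : φ u ≠ φ v) :
    cutSize φ (insert ⟨s(u, v), huv⟩ G) = cutSize φ G + 1 := by
  rw [cutSize_eq_card_filter, cutSize_eq_card_filter, Finset.filter_insert,
    if_pos (by simpa using hφ), Finset.card_insert_of_notMem]
  exact fun hmem => hG (Finset.mem_of_mem_filter _ hmem)

theorem cutSize_insert_of_eq {n r : ℕ} (φ : Fin n → Fin r) (G : FinGraph n) {u v : Fin n}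
    (huv : ¬ s(u, v).IsDiag) (hφ : φ u = φ v) :
    cutSize φ (insert ⟨s(u, v), huv⟩ G) = cutSize φ G := by
  rw [cutSize_eq_card_filter, cutSize_eq_card_filter, Finset.filter_insert,
    if_neg (by simpa using hφ)]

theorem cutSize_le_maxCut {n r : ℕ} (φ : Fin n → Fin r) (G : FinGraph n) :
    cutSize φ G ≤ maxCut n r G :=
  Finset.le_sup (f := fun φ : Fin n → Fin r => cutSize φ G) (Finset.mem_univ φ)

theorem exists_cutSize_eq_maxCut {n r : ℕ} [Nonempty (Fin n → Fin r)] (G : FinGraph n) :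
    ∃ φ : Fin n → Fin r, maxCut n r G = cutSize φ G := by
  obtain ⟨φ, -, hφ⟩ := Finset.exists_mem_eq_sup Finset.univ Finset.univ_nonempty
    fun φ : Fin n → Fin r => cutSize φ G
  exact ⟨φ, hφ⟩

/-- If `uv` is not an edge of `G` and `u, v` are not `(d+1,r)`-equivalent in `G`, then `u, v`
are not `(d,r)`-equivalent in `G ∪ uv`. -/
theorem not_eqv_insert
    (n r d : ℕ) (hr : 2 ≤ r) (G : FinGraph n) (u v : Fin n) (huv : u ≠ v)
    (hne : ∀ e ∈ G, (e : Sym2 (Fin n)) ≠ s(u, v))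
    (h : ¬ EqvV (d + 1) r G u v) :
    ¬ EqvV d r (insert (⟨s(u, v), by simpa using huv⟩ : EdgeType n) G) u v := by
  unfold EqvV at h ⊢
  push Not at h ⊢
  obtain ⟨φ, hφ, hφuv⟩ := h
  have : Nonempty (Fin n → Fin r) := ⟨φ⟩
  have hdiag : ¬ s(u, v).IsDiag := by simpa using huv
  obtain ⟨ψ, hψ⟩ := exists_cutSize_eq_maxCut (r := r) (insert ⟨s(u, v), hdiag⟩ G)
  by_cases hψuv : ψ u = ψ v
  · refine ⟨φ, ?_, hφuv⟩
    have hφ_insert := cutSize_insert_of_ne φ G hdiag (fun hmem => hne _ hmem rfl) hφuv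
    rw [cutSize_insert_of_eq ψ G hdiag hψuv] at hψ
    have hψ_le := cutSize_le_maxCut ψ G
    unfold deficit at hφ ⊢
    omega
  · refine ⟨ψ, ?_, hψuv⟩
    unfold deficit
    omega

end
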